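/- arXiv:0805.1390 — 2 statements merged into one kernel-verified Lean document; each statement's English description precedes it below -/
import Mathlib

section
/- Suppose S ⊂ ℝ^D lies within the closed ball B(x₀, Δ). Pick any 0 < δ ≤ 1 and 0 < ε ≤ 1 with δ·ε ≤ 1/e², and let ν be any probability measure supported on S. Pick a random vector U distributed as N(0, (1/D)·I_D). Then with probability greater than 1 − δ over the choice of U, the ν-measure of the set { x ∈ S : |U·x − U·x₀| > √(2·ln(1/(δε))) · Δ/√D } is at most ε. -/
open MeasureTheory ProbabilityTheory
open scoped NNReal ENNReal

/-- The distribution `N(0, (1/D)·I_D)` on `ℝ^D`: `D` independent coordinates, each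
Gaussian with mean `0` and variance `1/D`. -/
noncomputable def gaussPi (D : ℕ) : Measure (Fin D → ℝ) :=
  Measure.pi fun _ => gaussianReal 0 (D : ℝ≥0)⁻¹

open Set Filter Topology in
/-- Mills' inequality for the upper tail of the standard Gaussian. -/
theorem gaussianReal_Ioi_le {t : ℝ} (ht : 0 < t) :
    gaussianReal 0 1 (Ioi t) ≤
      ENNReal.ofReal ((√(2 * Real.pi))⁻¹ * t⁻¹ * Real.exp (-t ^ 2 / 2)) := by
  rw [gaussianReal_apply_eq_integral 0 one_ne_zero]
  apply ENNReal.ofReal_le_ofReal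
  have hderiv : ∀ x ∈ Ici t, HasDerivAt (fun x : ℝ => Real.exp (-x ^ 2 / 2))
      (-x * Real.exp (-x ^ 2 / 2)) x := by
    intro x _
    have h : HasDerivAt (fun x : ℝ => -x ^ 2 / 2) (-x) x := by
      exact ((hasDerivAt_pow 2 x).fun_neg.div_const 2).congr_deriv (by norm_num; ring)
    exact h.exp.congr_deriv (mul_comm _ _)
  have hnonpos : ∀ x ∈ Ioi t, -x * Real.exp (-x ^ 2 / 2) ≤ 0 := by
    intro x hx
    have hx0 : 0 < x := ht.trans hx
    have := mul_pos hx0 (Real.exp_pos (-x ^ 2 / 2))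
    linarith
  have htend : Tendsto (fun x : ℝ => Real.exp (-x ^ 2 / 2)) atTop (𝓝 0) := by
    refine Real.tendsto_exp_atBot.comp ?_
    have h : Tendsto (fun x : ℝ => x ^ 2 / 2) atTop atTop :=
      (tendsto_pow_atTop two_ne_zero).atTop_div_const two_pos
    exact (tendsto_neg_atTop_atBot.comp h).congr fun x => (neg_div _ _).symm
  have hint := integrableOn_Ioi_deriv_of_nonpos' hderiv hnonpos htend
  have hval := integral_Ioi_of_hasDerivAt_of_nonpos' hderiv hnonpos htend
  calc ∫ x in Ioi t, gaussianPDFReal 0 1 x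
      ≤ ∫ x in Ioi t, -((√(2 * Real.pi))⁻¹ * t⁻¹) * (-x * Real.exp (-x ^ 2 / 2)) := by
        refine setIntegral_mono_on (integrable_gaussianPDFReal 0 1).integrableOn
          (hint.const_mul _) measurableSet_Ioi fun x hx => ?_
        have h1 : 1 ≤ t⁻¹ * x := by
          rw [inv_mul_eq_div, one_le_div ht]
          exact le_of_lt hx
        have h2 : 0 ≤ (√(2 * Real.pi))⁻¹ * Real.exp (-x ^ 2 / 2) := by positivity
        simp only [gaussianPDFReal, NNReal.coe_one, mul_one, sub_zero]
        nlinarith [mul_le_mul_of_nonneg_right h1 h2]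
    _ = (√(2 * Real.pi))⁻¹ * t⁻¹ * Real.exp (-t ^ 2 / 2) := by
        rw [integral_const_mul, hval]
        ring

/-- Mills' inequality for the two-sided tail of the standard Gaussian. -/
theorem gaussianReal_lt_abs_le {t : ℝ} (ht : 0 < t) :
    gaussianReal 0 1 {z | t < |z|} ≤
      ENNReal.ofReal (2 * ((√(2 * Real.pi))⁻¹ * t⁻¹ * Real.exp (-t ^ 2 / 2))) := by
  have hsub : {z : ℝ | t < |z|} ⊆ Set.Ioi t ∪ (fun z => -z) ⁻¹' Set.Ioi t := by
    intro z hz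
    simpa [lt_abs, lt_neg] using hz
  have hneg : gaussianReal 0 1 ((fun z => -z) ⁻¹' Set.Ioi t) = gaussianReal 0 1 (Set.Ioi t) := by
    rw [← Measure.map_apply measurable_neg measurableSet_Ioi, gaussianReal_map_neg, neg_zero]
  calc gaussianReal 0 1 {z | t < |z|}
      ≤ gaussianReal 0 1 (Set.Ioi t) + gaussianReal 0 1 ((fun z => -z) ⁻¹' Set.Ioi t) :=
        (measure_mono hsub).trans (measure_union_le _ _)
    _ = 2 * gaussianReal 0 1 (Set.Ioi t) := by rw [hneg, two_mul]
    _ ≤ 2 * ENNReal.ofReal ((√(2 * Real.pi))⁻¹ * t⁻¹ * Real.exp (-t ^ 2 / 2)) := by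
        gcongr
        exact gaussianReal_Ioi_le ht
    _ = _ := by rw [ENNReal.ofReal_mul zero_le_two, ENNReal.ofReal_ofNat]

theorem gaussianReal_lt_abs_le_half_exp {t : ℝ} (ht : 2 ≤ t) :
    gaussianReal 0 1 {z | t < |z|} ≤ ENNReal.ofReal (Real.exp (-t ^ 2 / 2) / 2) := by
  refine (gaussianReal_lt_abs_le (by linarith)).trans (ENNReal.ofReal_le_ofReal ?_)
  have hpi : (√(2 * Real.pi))⁻¹ ≤ 2⁻¹ := by
    apply inv_anti₀ two_pos
    apply Real.le_sqrt_of_sq_le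
    linarith [Real.pi_gt_three]
  have ht' : t⁻¹ ≤ 2⁻¹ := inv_anti₀ two_pos ht
  calc 2 * ((√(2 * Real.pi))⁻¹ * t⁻¹ * Real.exp (-t ^ 2 / 2))
      ≤ 2 * (2⁻¹ * 2⁻¹ * Real.exp (-t ^ 2 / 2)) := by gcongr
    _ = _ := by ring

/-- A Gaussian tail bound that holds also for a degenerate variance. -/
theorem gaussianReal_lt_abs_le_of_le {t c : ℝ} {v : ℝ≥0} (hc : t * √v ≤ c) :
    gaussianReal 0 v {z | c < |z|} ≤ gaussianReal 0 1 {z | t < |z|} := by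
  have hmap : gaussianReal 0 v = (gaussianReal 0 1).map (√(v : ℝ) * ·) := by
    rw [gaussianReal_map_const_mul, mul_zero, mul_one]
    congr 1
    ext
    simp
  rw [hmap, Measure.map_apply (by fun_prop) (measurableSet_lt measurable_const (by fun_prop))]
  refine measure_mono fun z hz => ?_
  simp only [Set.preimage_ofPred_eq, Set.mem_ofPred_eq, abs_mul,
    abs_of_nonneg (Real.sqrt_nonneg _)] at hz ⊢
  by_contra! h
  nlinarith [mul_le_mul_of_nonneg_left h (Real.sqrt_nonneg (v : ℝ))]

/-- A linear combination of independent centered Gaussians of equal variance is Gaussian. -/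
theorem map_sum_mul_pi_gaussianReal {ι : Type*} [Fintype ι] (v w : ℝ≥0) (a : ι → ℝ)
    (hw : (w : ℝ) = v * ∑ i, a i ^ 2) :
    (Measure.pi fun _ : ι => gaussianReal 0 v).map (fun u => ∑ i, u i * a i) =
      gaussianReal 0 w := by
  have hmeas : Measurable fun u : ι → ℝ => ∑ i, u i * a i := by fun_prop
  have : IsProbabilityMeasure
      ((Measure.pi fun _ : ι => gaussianReal 0 v).map (fun u => ∑ i, u i * a i)) :=
    Measure.isProbabilityMeasure_map hmeas.aemeasurable
  apply Measure.ext_of_charFun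
  ext s
  rw [charFun_apply_real, integral_map hmeas.aemeasurable (by fun_prop)]
  have hprod : ∀ u : ι → ℝ, Complex.exp (s * ((∑ i, u i * a i : ℝ) : ℂ) * Complex.I) =
      ∏ i, Complex.exp (((s * a i : ℝ) : ℂ) * (u i : ℂ) * Complex.I) := by
    intro u
    rw [← Complex.exp_sum]
    congr 1
    push_cast
    rw [Finset.mul_sum, Finset.sum_mul]
    exact Finset.sum_congr rfl fun i _ => by ring
  simp_rw [hprod]
  rw [integral_fintype_prod_eq_prod
    (fun i (x : ℝ) => Complex.exp (((s * a i : ℝ) : ℂ) * (x : ℂ) * Complex.I))]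
  simp_rw [← charFun_apply_real, charFun_gaussianReal]
  rw [← Complex.exp_sum]
  congr 1
  have hw' : ((w : ℝ) : ℂ) = (v : ℝ) * ∑ i, (a i : ℂ) ^ 2 := by
    rw [hw]
    push_cast
    rfl
  rw [hw', Finset.mul_sum, Finset.sum_mul, Finset.sum_div, Complex.ofReal_zero, mul_zero,
    zero_mul, zero_sub, ← Finset.sum_neg_distrib]
  refine Finset.sum_congr rfl fun i _ => ?_
  push_cast
  ring

instance isProbabilityMeasure_gaussPi (D : ℕ) : IsProbabilityMeasure (gaussPi D) := by
  unfold gaussPi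
  infer_instance

/-- Tail bound for the projection of a single point onto the random direction. -/
theorem gaussPi_lt_abs_le {D : ℕ} {x x₀ : EuclideanSpace ℝ (Fin D)} {Δ t : ℝ}
    (hx : x ∈ Metric.closedBall x₀ Δ) (ht : 2 ≤ t) :
    gaussPi D {u | t * Δ / √D < |(∑ i, u i * x i) - ∑ i, u i * x₀ i|} ≤
      ENNReal.ofReal (Real.exp (-t ^ 2 / 2) / 2) := by
  obtain ⟨w, hw⟩ : ∃ w : ℝ≥0, (w : ℝ) = (D : ℝ)⁻¹ * ∑ i, (x i - x₀ i) ^ 2 :=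
    CanLift.prf (_ : ℝ) (by positivity)
  have hmap := map_sum_mul_pi_gaussianReal (D : ℝ≥0)⁻¹ w (fun i => x i - x₀ i)
    (by simpa using hw)
  have hset : {u : Fin D → ℝ | t * Δ / √D < |(∑ i, u i * x i) - ∑ i, u i * x₀ i|} =
      (fun u => ∑ i, u i * (x i - x₀ i)) ⁻¹' {z | t * Δ / √D < |z|} := by
    ext u
    simp [mul_sub, Finset.sum_sub_distrib]
  rw [hset, ← Measure.map_apply (by fun_prop) (measurableSet_lt measurable_const (by fun_prop)),
    gaussPi, hmap]
  refine (gaussianReal_lt_abs_le_of_le ?_).trans (gaussianReal_lt_abs_le_half_exp ht)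
  have hdist : √(∑ i, (x i - x₀ i) ^ 2) ≤ Δ := by
    have h := Metric.mem_closedBall.mp hx
    rw [EuclideanSpace.dist_eq] at h
    simpa [Real.dist_eq, sq_abs] using h
  rw [hw, Real.sqrt_mul (by positivity), Real.sqrt_inv, inv_mul_eq_div, mul_div_assoc]
  gcongr

/-- if `S ⊆ B(x₀, Δ)`, `0 < δ, ε ≤ 1` with `δε ≤ 1/e²`, and `ν` is a
probability measure supported on `S`, then with probability `> 1 − δ` over
`U ∼ N(0,(1/D)I_D)`, all but an `ε` fraction of `S` (measured by `ν`) projects within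
distance `√(2 ln(1/(δε)))·Δ/√D` of the projection of `x₀`. -/
theorem most_points_near_center {D : ℕ} (hD : 0 < D)
    (x₀ : EuclideanSpace ℝ (Fin D)) (Δ : ℝ)
    (S : Set (EuclideanSpace ℝ (Fin D))) (hS : S ⊆ Metric.closedBall x₀ Δ)
    (δ ε : ℝ) (hδ0 : 0 < δ) (hδ1 : δ ≤ 1) (hε0 : 0 < ε) (hε1 : ε ≤ 1)
    (hδε : δ * ε ≤ 1 / Real.exp 2)
    (ν : Measure (EuclideanSpace ℝ (Fin D))) [IsProbabilityMeasure ν]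
    (hν : ν Sᶜ = 0) :
    1 - ENNReal.ofReal δ <
      gaussPi D {u | ν {x | x ∈ S ∧
          Real.sqrt (2 * Real.log (1 / (δ * ε))) * Δ / Real.sqrt D
            < |(∑ i, u i * x i) - ∑ i, u i * x₀ i|}
        ≤ ENNReal.ofReal ε} := by
  set L := Real.log (1 / (δ * ε)) with hL
  have hpos : 0 < δ * ε := mul_pos hδ0 hε0
  have hL2 : 2 ≤ L := by
    rw [hL, Real.le_log_iff_exp_le (by positivity), le_div_iff₀ hpos]
    rwa [le_div_iff₀ (Real.exp_pos 2), mul_comm] at hδε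
  have ht : 2 ≤ √(2 * L) := Real.le_sqrt_of_sq_le (by linarith)
  have hexp : Real.exp (-√(2 * L) ^ 2 / 2) = δ * ε := by
    rw [Real.sq_sqrt (by linarith), neg_div, mul_div_cancel_left₀ _ two_ne_zero, hL, one_div,
      Real.log_inv, neg_neg, Real.exp_log hpos]
  set t := √(2 * L)
  let bad : Set ((Fin D → ℝ) × EuclideanSpace ℝ (Fin D)) :=
    {p | t * Δ / √D < |(∑ i, p.1 i * p.2 i) - ∑ i, p.1 i * x₀ i|}
  have hbad : MeasurableSet bad := measurableSet_lt measurable_const (by fun_prop)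
  let f : (Fin D → ℝ) → ℝ≥0∞ := fun u => ν (Prod.mk u ⁻¹' bad)
  have hf : Measurable f := measurable_measure_prodMk_left hbad
  have hSae : ∀ᵐ x ∂ν, x ∈ S := hν
  have hlint : ∫⁻ u, f u ∂(gaussPi D) ≤ ENNReal.ofReal (δ * ε / 2) := by
    calc ∫⁻ u, f u ∂(gaussPi D)
        = ∫⁻ x, gaussPi D ((fun u => (u, x)) ⁻¹' bad) ∂ν := by
          rw [← Measure.prod_apply hbad, Measure.prod_apply_symm hbad]
      _ ≤ ∫⁻ _, ENNReal.ofReal (δ * ε / 2) ∂ν := by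
          refine lintegral_mono_ae ?_
          filter_upwards [hSae] with x hx
          rw [← hexp]
          exact gaussPi_lt_abs_le (hS hx) ht
      _ = ENNReal.ofReal (δ * ε / 2) := by simp
  have hmarkov : gaussPi D {u | ENNReal.ofReal ε ≤ f u} < ENNReal.ofReal δ := by
    calc gaussPi D {u | ENNReal.ofReal ε ≤ f u}
        ≤ (∫⁻ u, f u ∂(gaussPi D)) / ENNReal.ofReal ε :=
          meas_ge_le_lintegral_div hf.aemeasurable (ENNReal.ofReal_pos.mpr hε0).ne'
            ENNReal.ofReal_ne_top
      _ ≤ ENNReal.ofReal (δ * ε / 2) / ENNReal.ofReal ε := by gcongr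
      _ = ENNReal.ofReal (δ / 2) := by
          rw [← ENNReal.ofReal_div_of_pos hε0]
          congr 1
          field_simp
      _ < ENNReal.ofReal δ := (ENNReal.ofReal_lt_ofReal_iff hδ0).mpr (by linarith)
  have hA : MeasurableSet {u | ENNReal.ofReal ε ≤ f u} := measurableSet_le measurable_const hf
  have hδ1' : ENNReal.ofReal δ ≤ 1 := ENNReal.ofReal_le_one.mpr hδ1
  calc 1 - ENNReal.ofReal δ
      < 1 - gaussPi D {u | ENNReal.ofReal ε ≤ f u} :=
        ENNReal.sub_lt_of_sub_lt hδ1' (Or.inl ENNReal.one_ne_top) <| by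
          rw [ENNReal.sub_sub_cancel ENNReal.one_ne_top prob_le_one]
          exact hmarkov
    _ = gaussPi D {u | ENNReal.ofReal ε ≤ f u}ᶜ := (prob_compl_eq_one_sub hA).symm
    _ ≤ _ := by
        refine measure_mono fun u hu => ?_
        have hu' : f u < ENNReal.ofReal ε := not_le.mp hu
        exact (measure_mono fun x hx => hx.2).trans hu'.le
end

section
/- Let n ≥ 1, let L = {1, ..., n} ∪ {1̄, ..., n̄} be a set of 2n literals with the involution α ↦ ᾱ exchanging i and ī, and let ∼ be any symmetric relation on L. Let 0 < δ and 0 < Δ < 1 satisfy 2δn ≤ 1 − Δ, and define the 2n × 2n symmetric matrix D by D_{αβ} = 1 − 1(α = β) + Δ·1(α = β̄) + δ·1(α ∼ β). Then for every u ∈ ℝ^{2n} with Σ_α u_α = 0, one has uᵀ D u ≤ 0. -/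
open Finset

/-- let `L = {1,…,n} ∪ {1̄,…,n̄}` be a set of `2n` literals (modelled as
`Fin n ⊕ Fin n`, with the involution `α ↦ ᾱ` given by `Sum.swap`), let `∼` be any
symmetric relation on `L`, and let `0 < δ`, `0 < Δ < 1` with `2δn ≤ 1 − Δ`. Define
`D_{αβ} = 1 − 1(α = β) + Δ·1(α = β̄) + δ·1(α ∼ β)`. Then `uᵀDu ≤ 0` for every `u`
with `Σ_α u_α = 0`. -/
theorem literal_matrix_negative_on_mean_zero (n : ℕ) (hn : 1 ≤ n)
    (r : (Fin n ⊕ Fin n) → (Fin n ⊕ Fin n) → Prop) [DecidableRel r]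
    (hr : Symmetric r) (δ Δ : ℝ) (hδ : 0 < δ) (hΔ0 : 0 < Δ) (hΔ1 : Δ < 1)
    (hbal : 2 * δ * n ≤ 1 - Δ)
    (u : (Fin n ⊕ Fin n) → ℝ) (hu : ∑ α, u α = 0) :
    ∑ α, ∑ β, u α *
        ((1 : ℝ) - (if α = β then 1 else 0) + Δ * (if α = Sum.swap β then 1 else 0)
          + δ * (if r α β then 1 else 0)) * u β ≤ 0 := by
  have hterm : ∀ α β, u α *
        ((1 : ℝ) - (if α = β then 1 else 0) + Δ * (if α = Sum.swap β then 1 else 0)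
          + δ * (if r α β then 1 else 0)) * u β
      ≤ u α * u β - (if α = β then u α ^ 2 else 0)
        + (if α = Sum.swap β then Δ * ((u α ^ 2 + u (Sum.swap α) ^ 2) / 2) else 0)
        + δ / 2 * (u α ^ 2 + u β ^ 2) := by
    intro α β
    have h₁ : u α * (if α = β then 1 else 0) * u β = if α = β then u α ^ 2 else 0 := by
      split_ifs with h
      · rw [h]; ring
      · ring
    have h₂ : u α * (Δ * (if α = Sum.swap β then 1 else 0)) * u β
        ≤ if α = Sum.swap β then Δ * ((u α ^ 2 + u (Sum.swap α) ^ 2) / 2) else 0 := by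
      split_ifs with h
      · subst h
        rw [Sum.swap_swap]
        nlinarith [mul_nonneg hΔ0.le (sq_nonneg (u (Sum.swap β) - u β))]
      · simp
    have h₃ : u α * (δ * (if r α β then 1 else 0)) * u β ≤ δ / 2 * (u α ^ 2 + u β ^ 2) := by
      split_ifs
      · nlinarith [mul_nonneg hδ.le (sq_nonneg (u α - u β))]
      · simp only [mul_zero, zero_mul]
        positivity
    linarith
  have hswap : ∑ α, u (Sum.swap α) ^ 2 = ∑ α, u α ^ 2 :=
    Equiv.sum_comp (Equiv.sumComm (Fin n) (Fin n)) fun α => u α ^ 2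
  have hrow : ∀ α, ∑ β, (u α * u β - (if α = β then u α ^ 2 else 0)
        + (if α = Sum.swap β then Δ * ((u α ^ 2 + u (Sum.swap α) ^ 2) / 2) else 0)
        + δ / 2 * (u α ^ 2 + u β ^ 2))
      = (δ * n + Δ / 2 - 1) * u α ^ 2 + Δ / 2 * u (Sum.swap α) ^ 2
        + δ / 2 * ∑ β, u β ^ 2 := by
    intro α
    have hiff : ∀ β, α = Sum.swap β ↔ Sum.swap α = β := fun β =>
      ⟨fun h => by rw [h, Sum.swap_swap], fun h => by rw [← h, Sum.swap_swap]⟩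
    simp only [hiff, sum_add_distrib, sum_sub_distrib, ← mul_sum, hu, sum_ite_eq, mem_univ,
      if_true, sum_const, card_univ, Fintype.card_sum, Fintype.card_fin, nsmul_eq_mul]
    push_cast
    ring
  have hS : 0 ≤ ∑ α, u α ^ 2 := sum_nonneg fun α _ => sq_nonneg (u α)
  refine (sum_le_sum fun α _ => sum_le_sum fun β _ => hterm α β).trans ?_
  simp only [hrow, sum_add_distrib, ← mul_sum, hswap, sum_const, card_univ, Fintype.card_sum,
    Fintype.card_fin, nsmul_eq_mul]
  push_cast
  nlinarith
end
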